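/- arXiv:2106.07707 — 2 statements merged into one kernel-verified Lean document; each statement's English description precedes it below -/
import Mathlib

section
/- Let ⟨A,∧,∨,→,∼,1⟩ be a Nelson algebra. Define x↣y:=(x→y)∧(∼y→∼x), 0:=∼1, and x∨'y:=((x↣0)∧(y↣0))↣0. Then the algebra ⟨A,∧,↣,0⟩ is a Brignole algebra, i.e., it satisfies all ten identities (B1)–(B10): (B1) (x↣x)↣y=y; (B2) (x↣y)∧y=y; (B3) x∧((x∧(y↣0))↣0)=x∧(x↣y); (B4) x↣(y∧z)=(x↣y)∧(x↣z); (B5) x↣y=(y↣0)↣(x↣0); (B6) x↣(x↣(y↣(y↣z)))=(x∧y)↣((x∧y)↣z); (B7) (((x↣0)∧y)↣0)↣(x↣y)=x↣y; (B8) x∧(x∨'y)=x; (B9) x∧(y∨'z)=(z∧x)∨'(y∧x); (B10) (x∧(x↣0))∧(y∨'(y↣0))=x∧(x↣0). -/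
/-- A Nelson algebra ⟨A,∧,∨,→,∼,1⟩ of type (2,2,2,1,0). -/
structure NelsonAlgebra (A : Type*) where
  meet : A → A → A
  join : A → A → A
  imp : A → A → A
  neg : A → A
  one : A
  n1 : ∀ x y, meet x (join x y) = x
  n2 : ∀ x y z, meet x (join y z) = join (meet z x) (meet y x)
  n3 : ∀ x, neg (neg x) = x
  n4 : ∀ x y, neg (meet x y) = join (neg x) (neg y)
  n5 : ∀ x y, meet x (neg x) = meet (meet x (neg x)) (join y (neg y))
  n6 : ∀ x, imp x x = one
  n7 : ∀ x y, meet x (imp x y) = meet x (join (neg x) y)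
  n8 : ∀ x y z, imp (meet x y) z = imp x (imp y z)

/-- The weak implication x↣y := (x→y)∧(∼y→∼x). -/
def NelsonAlgebra.wimp {A : Type*} (N : NelsonAlgebra A) (x y : A) : A :=
  N.meet (N.imp x y) (N.imp (N.neg y) (N.neg x))

namespace NelsonAlgebra

universe u

variable {A : Type*} (N : NelsonAlgebra A)

theorem aux_sq (x : A) : N.join (N.meet x x) (N.meet x x) = x := by
  rw [← N.n2, N.n1]

theorem meet_self' (x : A) : N.meet x x = x := by
  have h1 := N.aux_sq x
  have h2 : N.meet (N.meet x x) x = N.meet x x := by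
    have := N.n1 (N.meet x x) (N.meet x x)
    rwa [h1] at this
  have h3 := N.n2 x (N.meet x x) (N.meet x x)
  rw [h2, h1] at h3
  exact h3

theorem join_self' (x : A) : N.join x x = x := by
  have := N.aux_sq x
  rwa [N.meet_self'] at this

theorem meet_comm' (x y : A) : N.meet x y = N.meet y x := by
  have := N.n2 x y y
  rwa [N.join_self', N.join_self'] at this

theorem neg_join (x y : A) : N.neg (N.join x y) = N.meet (N.neg x) (N.neg y) := by
  have := N.n4 (N.neg x) (N.neg y)
  rw [N.n3, N.n3] at this
  rw [← this, N.n3]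

theorem join_comm' (x y : A) : N.join x y = N.join y x := by
  rw [← N.n3 (N.join x y), N.neg_join, N.meet_comm', ← N.neg_join, N.n3]

theorem join_absorb (x y : A) : N.join x (N.meet x y) = x := by
  have := congrArg N.neg (N.n1 (N.neg x) (N.neg y))
  rwa [N.n4, N.neg_join, N.n3, N.n3] at this

theorem distr' (x y z : A) :
    N.meet x (N.join y z) = N.join (N.meet x y) (N.meet x z) := by
  rw [N.n2, N.join_comm', N.meet_comm' y, N.meet_comm' z]

theorem join_assoc' (x y z : A) :
    N.join (N.join x y) z = N.join x (N.join y z) := by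
  have ab := N.n1
  have ab' : ∀ x y, N.meet x (N.join y x) = x := fun x y => by rw [N.join_comm', N.n1]
  have jb := N.join_absorb
  have jb' : ∀ x y, N.join (N.meet x y) x = x := fun x y => by rw [N.join_comm', N.join_absorb]
  have hx : N.meet x (N.join (N.join x y) z) = x := by rw [N.distr', ab, jb]
  have hy : N.meet y (N.join (N.join x y) z) = y := by rw [N.distr', ab', jb]
  have hz : N.meet z (N.join (N.join x y) z) = z := ab' _ _
  have kx : N.meet x (N.join x (N.join y z)) = x := ab _ _
  have ky : N.meet y (N.join x (N.join y z)) = y := by rw [N.distr', ab, jb']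
  have kz : N.meet z (N.join x (N.join y z)) = z := by rw [N.distr', ab', jb']
  have e1 : N.meet (N.join (N.join x y) z) (N.join x (N.join y z))
      = N.join x (N.join y z) := by
    rw [N.distr', N.distr', N.meet_comm' _ x, N.meet_comm' _ y, N.meet_comm' _ z, hx, hy, hz]
  have e2 : N.meet (N.join x (N.join y z)) (N.join (N.join x y) z)
      = N.join (N.join x y) z := by
    rw [N.distr', N.distr', N.meet_comm' _ x, N.meet_comm' _ y, N.meet_comm' _ z, kx, ky, kz]
  rw [← e2, N.meet_comm', e1]

theorem meet_assoc' (x y z : A) :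
    N.meet (N.meet x y) z = N.meet x (N.meet y z) := by
  have := congrArg N.neg (N.join_assoc' (N.neg x) (N.neg y) (N.neg z))
  simpa only [N.neg_join, N.n3] using this

/-- The lattice reduct. -/
@[reducible] def lat : DistribLattice A :=
  letI : Max A := ⟨N.join⟩
  letI : Min A := ⟨N.meet⟩
  letI L : Lattice A := Lattice.mk' N.join_comm' N.join_assoc' N.meet_comm' N.meet_assoc'
    N.join_absorb N.n1
  DistribLattice.ofInfSupLe (fun a b c => le_of_eq (N.distr' a b c))

/-- The quasi-order. -/
def qle (x y : A) : Prop := N.imp x y = N.one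

theorem le_iff (x y : A) : N.lat.le x y ↔ N.meet x y = x :=
  letI := N.lat
  (inf_eq_left (a := x) (b := y)).symm

theorem neg_anti {x y : A} (h : N.lat.le x y) : N.lat.le (N.neg y) (N.neg x) := by
  rw [le_iff] at *
  rw [← N.neg_join, ← h, N.meet_comm' x, N.join_absorb]

theorem kleene (x y : A) : N.lat.le (N.meet x (N.neg x)) (N.join y (N.neg y)) := by
  rw [le_iff, ← N.n5]

theorem le_one (x : A) : N.lat.le x N.one := by
  rw [le_iff, ← N.n6 x, N.n7, N.join_comm', N.n1]

theorem imp_one (x : A) : N.imp x N.one = N.one := by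
  rw [← N.n6 x, ← N.n8, N.meet_self']

theorem qle_of_le {x y : A} (h : N.lat.le x y) : N.qle x y := by
  rw [le_iff] at h
  rw [qle, ← h, N.n8, N.n6, N.imp_one]

theorem qle_iff (x y : A) : N.qle x y ↔ N.lat.le x (N.join (N.neg x) y) := by
  rw [le_iff, ← N.n7]
  constructor
  · intro h
    rw [qle] at h
    rw [h]
    exact (N.le_iff _ _).1 (N.le_one x)
  · intro h
    have := N.qle_of_le ((N.le_iff _ _).2 h)
    rwa [qle, ← N.n8, N.meet_self'] at this

theorem qle_imp (x y z : A) : N.qle z (N.imp x y) ↔ N.qle (N.meet z x) y := by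
  rw [qle, qle, N.n8]

theorem qle_trans {x y z : A} (h1 : N.qle x y) (h2 : N.qle y z) : N.qle x z := by
  rw [qle_iff] at *
  have h3 := N.neg_anti h1
  rw [N.neg_join, N.n3] at h3
  letI := N.lat
  change x ≤ N.neg x ⊔ y at h1
  change y ≤ N.neg y ⊔ z at h2
  change x ⊓ N.neg y ≤ N.neg x at h3
  change x ≤ N.neg x ⊔ z
  have a1 : x ≤ N.neg x ⊔ (N.neg y ⊔ z) := h1.trans (sup_le_sup_left h2 _)
  calc x ≤ x ⊓ (N.neg x ⊔ (N.neg y ⊔ z)) := le_inf le_rfl a1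
    _ = (x ⊓ N.neg x) ⊔ ((x ⊓ N.neg y) ⊔ (x ⊓ z)) := by rw [inf_sup_left, inf_sup_left]
    _ ≤ _ := sup_le (inf_le_right.trans le_sup_left)
        (sup_le (h3.trans le_sup_left) (inf_le_right.trans le_sup_right))

theorem qle_meet {x y z : A} (h1 : N.qle x y) (h2 : N.qle x z) : N.qle x (N.meet y z) := by
  rw [qle_iff] at *
  letI := N.lat
  change x ≤ N.neg x ⊔ y at h1
  change x ≤ N.neg x ⊔ z at h2
  change x ≤ N.neg x ⊔ (y ⊓ z)
  rw [sup_inf_left]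
  exact le_inf h1 h2

theorem join_qle {x y z : A} (h1 : N.qle x z) (h2 : N.qle y z) : N.qle (N.join x y) z := by
  rw [qle_iff] at *
  rw [N.neg_join]
  have k1 := N.kleene x y
  have k2 := N.kleene y x
  letI := N.lat
  change x ≤ N.neg x ⊔ z at h1
  change y ≤ N.neg y ⊔ z at h2
  change x ⊓ N.neg x ≤ y ⊔ N.neg y at k1
  change y ⊓ N.neg y ≤ x ⊔ N.neg x at k2
  change x ⊔ y ≤ (N.neg x ⊓ N.neg y) ⊔ z
  have key : ∀ a b a' b' : A, a ≤ a' ⊔ z → b ≤ b' ⊔ z → a ⊓ a' ≤ b ⊔ b' → a ≤ (a' ⊓ b') ⊔ z := by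
    intro a b a' b' ha hb hk
    rw [sup_inf_right]
    refine le_inf ha ?_
    calc a ≤ a ⊓ (a' ⊔ z) := le_inf le_rfl ha
      _ = (a ⊓ a') ⊔ (a ⊓ z) := inf_sup_left _ _ _
      _ ≤ _ := sup_le (hk.trans (sup_le hb le_sup_left)) (inf_le_right.trans le_sup_right)
  refine sup_le (key _ _ _ _ h1 h2 k1) ?_
  rw [inf_comm]
  exact key _ _ _ _ h2 h1 k2

theorem le_of_qle {x y : A} (h1 : N.qle x y) (h2 : N.qle (N.neg y) (N.neg x)) :
    N.lat.le x y := by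
  rw [qle_iff] at *
  have h3 := N.neg_anti h2
  rw [N.neg_join, N.n3, N.n3, N.n3] at h3
  have k := N.kleene x y
  letI := N.lat
  change x ≤ N.neg x ⊔ y at h1
  change N.neg y ⊓ x ≤ y at h3
  change x ⊓ N.neg x ≤ y ⊔ N.neg y at k
  have a : x ⊓ N.neg x ≤ y := by
    calc x ⊓ N.neg x ≤ x ⊓ (y ⊔ N.neg y) := le_inf inf_le_left k
      _ = (x ⊓ y) ⊔ (x ⊓ N.neg y) := inf_sup_left _ _ _
      _ ≤ _ := sup_le inf_le_right (by rw [inf_comm]; exact h3)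
  calc x ≤ x ⊓ (N.neg x ⊔ y) := le_inf le_rfl h1
    _ = (x ⊓ N.neg x) ⊔ (x ⊓ y) := inf_sup_left _ _ _
    _ ≤ _ := sup_le a inf_le_right

theorem meet_qle_left (x y : A) : N.qle (N.meet x y) x :=
  N.qle_of_le (letI := N.lat; inf_le_left (a := x) (b := y))
theorem meet_qle_right (x y : A) : N.qle (N.meet x y) y :=
  N.qle_of_le (letI := N.lat; inf_le_right (a := x) (b := y))
theorem qle_join_left (x y : A) : N.qle x (N.join x y) :=
  N.qle_of_le (letI := N.lat; le_sup_left (a := x) (b := y))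
theorem qle_join_right (x y : A) : N.qle y (N.join x y) :=
  N.qle_of_le (letI := N.lat; le_sup_right (a := x) (b := y))

theorem meet_neg_qle (x y : A) : N.qle (N.meet x (N.neg x)) y := by
  rw [qle_iff, N.n4, N.n3]
  letI := N.lat
  change x ⊓ N.neg x ≤ (N.neg x ⊔ x) ⊔ y
  exact inf_le_right.trans (le_sup_left.trans le_sup_left)

theorem zero_qle (x : A) : N.qle (N.neg N.one) x := by
  have := N.neg_anti (N.le_one (N.neg x))
  rw [N.n3] at this
  exact N.qle_of_le this

theorem neg_imp_qle (x y : A) : N.qle (N.neg (N.imp x y)) (N.meet x (N.neg y)) := by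
  have h := congrArg N.neg (N.n7 x y)
  rw [N.n4, N.n4, N.neg_join, N.n3] at h
  have h1 : N.qle (N.neg x) (N.imp x y) := by
    rw [qle_imp, N.meet_comm']
    exact N.meet_neg_qle _ _
  have h2 : N.qle (N.meet (N.neg x) (N.neg (N.imp x y))) (N.meet x (N.neg y)) :=
    N.qle_trans (N.qle_meet (N.qle_trans (N.meet_qle_left _ _) h1) (N.meet_qle_right _ _))
      (N.meet_neg_qle _ _)
  have h3 : N.neg (N.imp x y) = N.join (N.meet (N.neg (N.imp x y)) (N.neg x))
      (N.meet (N.neg (N.imp x y)) (N.meet x (N.neg y))) := by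
    rw [← N.distr', ← h, N.join_comm', N.n1]
  rw [h3]
  refine N.join_qle ?_ (N.meet_qle_right _ _)
  rw [N.meet_comm']
  exact h2

theorem qle_neg_imp (x y : A) : N.qle (N.meet x (N.neg y)) (N.neg (N.imp x y)) := by
  have h := congrArg N.neg (N.n7 x y)
  rw [N.n4, N.n4, N.neg_join, N.n3] at h
  have h3 : N.meet x (N.neg y) = N.join (N.meet (N.meet x (N.neg y)) (N.neg x))
      (N.meet (N.meet x (N.neg y)) (N.neg (N.imp x y))) := by
    rw [← N.distr', h, N.join_comm', N.n1]
  rw [h3]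
  refine N.join_qle ?_ (N.meet_qle_right _ _)
  exact N.qle_trans (N.qle_meet (N.qle_trans (N.meet_qle_left _ _) (N.meet_qle_left _ _))
    (N.meet_qle_right _ _)) (N.meet_neg_qle _ _)

/-- The preorder. -/
@[reducible] def pre : Preorder A where
  le := N.qle
  le_refl := N.n6
  le_trans _ _ _ := N.qle_trans

theorem represent {A : Type u} (N : NelsonAlgebra A) : ∃ (H : Type u) (_ : HeytingAlgebra H) (f : A → H),
    (∀ x y, f x ≤ f y ↔ N.qle x y) ∧ (∀ x y, f (N.meet x y) = f x ⊓ f y) ∧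
    (∀ x y, f (N.join x y) = f x ⊔ f y) ∧
    (∀ x y, f (N.imp x y) = f x ⇨ f y) ∧ f N.one = ⊤ ∧ f (N.neg N.one) = ⊥ := by
  letI := N.pre
  let H := Antisymmetrization A (· ≤ ·)
  let f : A → H := toAntisymmetrization (· ≤ ·)
  have hf : ∀ x y, f x ≤ f y ↔ N.qle x y := fun x y => Iff.rfl
  have hs : ∀ h : H, f (ofAntisymmetrization _ h) = h := fun h => toAntisymmetrization_ofAntisymmetrization _ h
  let g : H → A := ofAntisymmetrization _
  have hgl : ∀ a b : H, a ≤ b ↔ N.qle (g a) (g b) := fun a b => by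
    rw [← hf, hs, hs]
  have hl : ∀ (x : A) (b : H), f x ≤ b ↔ N.qle x (g b) := fun x b => by
    rw [← hf, hs]
  have hr : ∀ (a : H) (y : A), a ≤ f y ↔ N.qle (g a) y := fun x b => by
    rw [← hf, hs]
  letI L : Lattice H :=
    { (inferInstance : PartialOrder H) with
      sup := fun a b => f (N.join (g a) (g b))
      inf := fun a b => f (N.meet (g a) (g b))
      le_sup_left := fun a b => (hr _ _).2 (N.qle_join_left _ _)
      le_sup_right := fun a b => (hr _ _).2 (N.qle_join_right _ _)
      sup_le := fun a b c h1 h2 => (hl _ _).2 (N.join_qle ((hgl _ _).1 h1) ((hgl _ _).1 h2))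
      inf_le_left := fun a b => (hl _ _).2 (N.meet_qle_left _ _)
      inf_le_right := fun a b => (hl _ _).2 (N.meet_qle_right _ _)
      le_inf := fun a b c h1 h2 => (hr _ _).2 (N.qle_meet ((hgl _ _).1 h1) ((hgl _ _).1 h2)) }
  have hmeet : ∀ x y, f (N.meet x y) = f x ⊓ f y := fun x y =>
    le_antisymm (le_inf ((hf _ _).2 (N.meet_qle_left _ _)) ((hf _ _).2 (N.meet_qle_right _ _)))
      ((hr _ _).2 (N.qle_meet ((hr _ _).1 inf_le_left) ((hr _ _).1 inf_le_right)))
  have hjoin : ∀ x y, f (N.join x y) = f x ⊔ f y := fun x y =>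
    le_antisymm ((hl _ _).2 (N.join_qle ((hl _ _).1 le_sup_left) ((hl _ _).1 le_sup_right)))
      (sup_le ((hf _ _).2 (N.qle_join_left _ _)) ((hf _ _).2 (N.qle_join_right _ _)))
  letI HA : HeytingAlgebra H :=
    { L with
      top := f N.one
      bot := f (N.neg N.one)
      himp := fun a b => f (N.imp (g a) (g b))
      compl := fun a => f (N.imp (g a) (g (f (N.neg N.one))))
      le_top := fun a => (hr _ _).2 (N.imp_one _)
      bot_le := fun a => (hl _ _).2 (N.zero_qle _)
      le_himp_iff := fun a b c => by
        rw [hr, N.qle_imp, ← hl, hmeet, hs, hs]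
      himp_bot := fun a => rfl }
  refine ⟨H, HA, f, hf, hmeet, hjoin, ?_, rfl, rfl⟩
  intro x y
  apply eq_of_forall_le_iff
  intro c
  rw [le_himp_iff, hr, N.qle_imp, ← hf, hmeet, hs]

/-- Twist-structure representation. -/
theorem twist {A : Type u} (N : NelsonAlgebra A) : ∃ (H : Type u) (_ : HeytingAlgebra H) (f g : A → H),
    (∀ x y, f x = f y → g x = g y → x = y) ∧
    (∀ x, f x ⊓ g x = ⊥) ∧ (∀ x, g x ⊓ f x = ⊥) ∧
    (∀ x, f (N.neg x) = g x) ∧ (∀ x, g (N.neg x) = f x) ∧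
    (∀ x y, f (N.meet x y) = f x ⊓ f y) ∧ (∀ x y, g (N.meet x y) = g x ⊔ g y) ∧
    (∀ x y, f (N.imp x y) = f x ⇨ f y) ∧ (∀ x y, g (N.imp x y) = f x ⊓ g y) ∧
    f N.one = ⊤ ∧ g N.one = ⊥ := by
  obtain ⟨H, HA, f, hf, hm, hj, hi, h1, h0⟩ := N.represent
  have hb : ∀ x, f x ⊓ f (N.neg x) = ⊥ := fun x => by
    rw [← hm, ← le_bot_iff, ← h0, hf]
    exact N.meet_neg_qle _ _
  refine ⟨H, HA, f, fun x => f (N.neg x), ?_, hb, fun x => by rw [inf_comm]; exact hb x,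
    fun _ => rfl, fun x => by simp only [N.n3], hm, fun x y => by simp only [N.n4, hj], hi,
    ?_, h1, h0⟩
  · intro x y e1 e2
    have a := N.le_of_qle ((hf x y).1 e1.le) ((hf _ _).1 e2.ge)
    have b := N.le_of_qle ((hf y x).1 e1.ge) ((hf _ _).1 e2.le)
    exact @le_antisymm A N.lat.toPartialOrder _ _ a b
  · intro x y
    change f _ = f _ ⊓ f _
    rw [← hm]
    exact le_antisymm ((hf _ _).2 (N.neg_imp_qle _ _)) ((hf _ _).2 (N.qle_neg_imp _ _))

end NelsonAlgebra

/-- A Nelson algebra with x↣y := (x→y)∧(∼y→∼x) and 0 := ∼1 yields a Brignole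
algebra: all ten identities (B1)–(B10) hold, where ∨' x y := ((x↣0)∧(y↣0))↣0. -/
theorem nelson_to_brignole {A : Type*} (N : NelsonAlgebra A) :
    (∀ x y, N.wimp (N.wimp x x) y = y) ∧
    (∀ x y, N.meet (N.wimp x y) y = y) ∧
    (∀ x y, N.meet x (N.wimp (N.meet x (N.wimp y (N.neg N.one))) (N.neg N.one)) =
      N.meet x (N.wimp x y)) ∧
    (∀ x y z, N.wimp x (N.meet y z) = N.meet (N.wimp x y) (N.wimp x z)) ∧
    (∀ x y, N.wimp x y = N.wimp (N.wimp y (N.neg N.one)) (N.wimp x (N.neg N.one))) ∧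
    (∀ x y z, N.wimp x (N.wimp x (N.wimp y (N.wimp y z))) =
      N.wimp (N.meet x y) (N.wimp (N.meet x y) z)) ∧
    (∀ x y, N.wimp (N.wimp (N.meet (N.wimp x (N.neg N.one)) y) (N.neg N.one))
      (N.wimp x y) = N.wimp x y) ∧
    (∀ x y, N.meet x
      (N.wimp (N.meet (N.wimp x (N.neg N.one)) (N.wimp y (N.neg N.one))) (N.neg N.one)) = x) ∧
    (∀ x y z, N.meet x
      (N.wimp (N.meet (N.wimp y (N.neg N.one)) (N.wimp z (N.neg N.one))) (N.neg N.one)) =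
      N.wimp (N.meet (N.wimp (N.meet z x) (N.neg N.one))
        (N.wimp (N.meet y x) (N.neg N.one))) (N.neg N.one)) ∧
    (∀ x y, N.meet (N.meet x (N.wimp x (N.neg N.one)))
      (N.wimp (N.meet (N.wimp y (N.neg N.one))
        (N.wimp (N.wimp y (N.neg N.one)) (N.neg N.one))) (N.neg N.one)) =
      N.meet x (N.wimp x (N.neg N.one))) := by
  obtain ⟨H, HA, f, g, inj, fg, gf, fn, gn, fm, gm, fi, gi, f1, g1⟩ := N.twist
  have fw : ∀ x y, f (N.wimp x y) = (f x ⇨ f y) ⊓ (g y ⇨ g x) := fun x y => by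
    simp only [NelsonAlgebra.wimp, fm, fi, fn]
  have gw : ∀ x y, g (N.wimp x y) = f x ⊓ g y := fun x y => by
    simp only [NelsonAlgebra.wimp, gm, gi, fn, gn]
    rw [inf_comm (g y), sup_idem]
  have fc : ∀ x, f x ≤ (g x)ᶜ := fun x => le_compl_iff_disjoint_right.2 (disjoint_iff.2 (fg x))
  have gc : ∀ x, g x ≤ (f x)ᶜ := fun x => le_compl_iff_disjoint_right.2 (disjoint_iff.2 (gf x))
  have w0 : ∀ x, N.wimp x (N.neg N.one) = N.neg x := fun x => by
    apply inj
    · rw [fw, fn, gn, fn, f1, g1, himp_bot, top_himp, inf_eq_right]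
      exact gc x
    · rw [gw, gn, gn, f1, inf_top_eq]
  have ww : ∀ x y, N.wimp x (N.wimp x y) = N.imp x y := fun x y => by
    apply inj
    · rw [fw, fw, gw, fi]
      apply le_antisymm
      · exact inf_le_left.trans (by rw [himp_inf_distrib, himp_idem]; exact inf_le_left)
      · refine le_inf ?_ ?_
        · rw [himp_inf_distrib, himp_idem]
          refine le_inf le_rfl ?_
          rw [le_himp_iff, le_himp_iff, himp_inf_self, inf_comm (f y), inf_assoc, fg, inf_bot_eq]
          exact bot_le
        · rw [le_himp_iff, ← inf_assoc, himp_inf_self, inf_comm (f y), inf_assoc, fg, inf_bot_eq]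
          exact bot_le
    · rw [gw, gw, gi, ← inf_assoc, inf_idem]
  simp only [w0]
  refine ⟨?_, ?_, ?_, ?_, ?_, ?_, ?_, ?_, ?_, ?_⟩
  · intro x y
    apply inj
    · rw [fw, fw, gw, himp_self, himp_self, fg, inf_top_eq, top_himp, himp_bot, inf_eq_left]
      exact fc y
    · rw [gw, fw, himp_self, himp_self, inf_top_eq, top_inf_eq]
  · intro x y
    apply inj
    · rw [fm, fw, inf_eq_right]
      refine le_inf le_himp ?_
      rw [le_himp_iff, fg]
      exact bot_le
    · rw [gm, gw, sup_eq_right]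
      exact inf_le_right
  · intro x y
    apply inj
    · rw [fm, fm, fn, gm, gn, fw, inf_sup_left, fg, bot_sup_eq, ← inf_assoc, inf_himp]
      symm
      rw [inf_eq_left, le_himp_iff, inf_assoc, fg, inf_bot_eq]
      exact bot_le
    · rw [gm, gm, gn, fm, fn, gw]
  · intro x y z
    apply inj
    · rw [fm, fw, fw, fw, fm, gm, himp_inf_distrib, sup_himp_distrib]
      ac_rfl
    · rw [gm, gw, gw, gw, gm, inf_sup_left]
  · intro x y
    apply inj
    · rw [fw, fw, fn, gn, fn, gn, inf_comm]
    · rw [gw, gw, fn, gn, inf_comm]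
  · intro x y z
    rw [ww, ww, ww, N.n8]
  · intro x y
    have e : g x ⊓ f y = f y ⊓ g x := inf_comm _ _
    apply inj
    · rw [fw (N.neg _), fn, gn, gm, fm, fn, gn, gw]
      apply le_antisymm
      · refine inf_le_left.trans ?_
        rw [sup_himp_distrib, fw]
        refine le_inf (inf_le_left.trans ?_) (inf_le_right.trans ?_)
        · rw [himp_inf_distrib, himp_idem]; exact inf_le_left
        · rw [himp_inf_distrib, himp_idem]; exact inf_le_right
      · refine le_inf le_himp ?_
        rw [le_himp_iff, fw]
        have : (f x ⇨ f y) ⊓ (g y ⇨ g x) ⊓ (f x ⊓ g y) ≤ f y ⊓ g y := by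
          refine le_inf ?_ (inf_le_right.trans inf_le_right)
          exact (inf_le_inf inf_le_left inf_le_left).trans (by rw [himp_inf_self]; exact inf_le_left)
        rw [fg] at this
        exact this.trans bot_le
    · rw [gw (N.neg _), fn, gm, gn, gw, inf_eq_right]
      exact inf_le_left.trans le_sup_left
  · intro x y
    rw [N.n4, N.n3, N.n3, N.n1]
  · intro x y z
    rw [N.n4, N.n3, N.n3, N.n4, N.n3, N.n3, N.n2]
  · intro x y
    rw [N.n4, N.n3, ← N.n5]
end

section
/- Let ⟨A,∧,↣,0⟩ be an algebra of type (2,2,0) satisfying axioms (B1), (B3), (B4), (B5), (B6), (B7), (B9) and (B10) (but not assuming (B2) or (B8)). Then 0 is absorbing for ∧: for every x in A, x∧0 = 0. -/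
/-- An algebra ⟨A,∧,↣,0⟩ of type (2,2,0) satisfying the Brignole axioms
(B1), (B3), (B4), (B5), (B6), (B7), (B9) and (B10), but NOT assuming
(B2) or (B8).  The abbreviations ∼x := x↣0 and
x∨y := ((x↣0)∧(y↣0))↣0 are written out in the axioms. -/
structure BrignoleCore (A : Type*) where
  meet : A → A → A
  himp : A → A → A
  zero : A
  b1 : ∀ x y, himp (himp x x) y = y
  b3 : ∀ x y, meet x (himp (meet x (himp y zero)) zero) = meet x (himp x y)
  b4 : ∀ x y z, himp x (meet y z) = meet (himp x y) (himp x z)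
  b5 : ∀ x y, himp x y = himp (himp y zero) (himp x zero)
  b6 : ∀ x y z, himp x (himp x (himp y (himp y z))) =
    himp (meet x y) (himp (meet x y) z)
  b7 : ∀ x y, himp (himp (meet (himp x zero) y) zero) (himp x y) = himp x y
  b9 : ∀ x y z, meet x (himp (meet (himp y zero) (himp z zero)) zero) =
    himp (meet (himp (meet z x) zero) (himp (meet y x) zero)) zero
  b10 : ∀ x y, meet (meet x (himp x zero))
      (himp (meet (himp y zero) (himp (himp y zero) zero)) zero) =
    meet x (himp x zero)

theorem bc_aux {A : Type*} (m h : A → A → A) (o u : A) (n : A → A) (j : A → A → A)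
  (hn : ∀ x, n (n x) = x) (h0 : ∀ x, h x o = n x) (n0 : n o = u) (nu : n u = o)
  (hxx : ∀ x, h x x = u) (hu : ∀ x, h u x = x)
  (j1 : ∀ x y, n (m x y) = j (n x) (n y)) (j2 : ∀ x y, n (j x y) = m (n x) (n y))
  (mi : ∀ x, m x x = x) (ji : ∀ x, j x x = x) (mc : ∀ x y, m x y = m y x)
  (d1 : ∀ x y z, m x (j y z) = j (m x y) (m x z))
  (b3 : ∀ x y, m x (h x y) = m x (j (n x) y))
  (b4 : ∀ x y z, h x (m y z) = m (h x y) (h x z))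
  (b4' : ∀ x y z, h (j y z) x = m (h y x) (h z x))
  (b6 : ∀ x y z, h x (h x (h y (h y z))) = h (m x y) (h (m x y) z))
  (b7 : ∀ x y, m (h x (h x y)) (h (n y) (h x y)) = h x y)
  (b10 : ∀ x y, m (m x (n x)) (j y (n y)) = m x (n x)) (x : A) : m x o = o := by
  have jc : ∀ x y, j x y = j y x := fun x y => by
    rw [← hn (j x y), j2, mc, ← j2, hn]
  -- x ∧ 1 = x ∨ 0
  have e0 : ∀ x, m x u = m x (j x (n x)) := fun x => by
    rw [← hxx x, b3, jc]
  have d2 : ∀ x y z, j x (m y z) = m (j x y) (j x z) := fun x y z => by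
    have := congrArg n (d1 (n x) (n y) (n z))
    simpa only [j1, j2, hn] using this
  have e1 : ∀ x, j x o = m x u := fun x => by
    have := congrArg n (e0 (n x))
    simp only [j1, j2, hn, nu] at this
    rw [this, e0, d1, mi]
  have ou : m o u = o := by rw [← e1, ji]
  have o10 : ∀ y, m o (j y (n y)) = o := fun y => by
    have := b10 o y
    rwa [n0, ou] at this
  obtain ⟨s, hs⟩ : ∃ s, s = j u (n x) := ⟨_, rfl⟩
  obtain ⟨r, hr⟩ : ∃ r, m s r = u := by
    refine ⟨h (n x) s, ?_⟩
    have := hxx s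
    nth_rewrite 1 [hs] at this
    rwa [b4', hu] at this
  have id1 : ∀ z, h s (h s z) = z := fun z => by
    have k1 : ∀ z, h s (h s (h r (h r z))) = z := fun z => by rw [b6, hr, hu, hu]
    have k2 : ∀ z, h s (h s (h s (h s z))) = h s (h s z) := fun z => by rw [b6, mi]
    have := k2 (h r (h r z))
    rwa [k1] at this
  have s1 : h s u = s := by have := id1 s; rwa [hxx] at this
  have w0 : m o (n s) = n s := by
    have := b7 s o
    rwa [id1, n0, hu, h0] at this
  have sn : h s (n s) = o := by rw [← h0 s, id1]
  have sw : m s o = m s (n s) := by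
    have := b3 s (n s)
    rwa [sn, ji] at this
  have sw' : j s (n s) = j u (n s) := by
    have := congrArg n sw
    rw [j1, j1, hn, n0] at this
    rw [jc s, ← this, jc]
  have ow : j o (n s) = o := by
    have := o10 s
    rwa [sw', d1, ou, w0] at this
  have su : m s u = u := by
    have := congrArg n ow
    rwa [j2, hn, n0, mc] at this
  have : s = u := by
    have k := b4 s s u
    rw [su, s1, hxx, mc, su] at k
    exact k
  have k := congrArg n (hs.symm.trans this)
  rwa [j2, hn, nu, mc] at k

theorem brignoleCore_meet_zero {A : Type*} (B : BrignoleCore A) (x : A) :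
    B.meet x B.zero = B.zero := by
  obtain ⟨m, h, o, b1, b3, b4, b5, b6, b7, b9, b10⟩ := B
  dsimp only
  have hn : ∀ x, h (h x o) o = x := fun x => by
    have := b5 (h o o) x
    rw [b1, b1] at this
    exact this.symm
  have hxx : ∀ x, h x x = h o o := fun x => by
    rw [← hn (h x x), b1]
  have mi : ∀ x, m x x = x := fun x => by
    have k : m o o = o := by
      have := b7 (h o o) o
      rwa [b1, hn] at this
    have := b4 (h x o) o o
    rw [k, hn] at this
    exact this.symm
  have mc : ∀ x y, m x y = m y x := fun x y => by
    have := b9 x y y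
    rwa [mi, hn, mi, hn] at this
  have b4' : ∀ x y z, h (h (m (h y o) (h z o)) o) x = m (h y x) (h z x) := fun x y z => by
    rw [b5, hn, b4, ← b5, ← b5]
  refine bc_aux m h o (h o o) (fun x => h x o) (fun x y => h (m (h x o) (h y o)) o)
    hn (fun _ => rfl) rfl (b1 _ _) hxx (b1 o) ?_ ?_ mi ?_ mc ?_ ?_ b4 b4' b6 ?_ b10 x
  · intro x y; simp only [hn]
  · intro x y; simp only [hn]
  · intro x; simp only [mi, hn]
  · intro x y z
    rw [b9, mc z, mc y, mc (h _ _)]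
  · intro x y
    simp only [hn]
    exact (b3 x y).symm
  · intro x y
    have := b7 x y
    have k := b4' (h x y) x (h y o)
    rw [hn] at k
    rwa [k] at this
end
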